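/- (Key integral expansion in the proofs.) Let g: ℝ → ℝ be bounded and measurable, four times continuously differentiable on a neighborhood of 0, with g′(0) = 0. Let (h_n) and (a_n) be real sequences with h_n > 0, h_n → 0 and a_n/h_n → 0. Then ∫_ℝ t φ(t) g(t h_n − a_n) dt = −g″(0) h_n a_n + (g‴(0)/2) h_n³ + o(h_n³ + h_n |a_n|) as n → ∞, where φ is the standard normal density. -/

import Mathlib

open MeasureTheory Filter Real Asymptotics

/-- The standard normal density. -/
noncomputable def stdNormalPDF (t : ℝ) : ℝ := (Real.sqrt (2 * Real.pi))⁻¹ * Real.exp (-(t ^ 2) / 2)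

lemma aux_integrable (n : ℕ) : Integrable (fun t : ℝ => t ^ n * stdNormalPDF t) := by
  have h := integrable_rpow_mul_exp_neg_mul_sq (b := 1/2) (by norm_num) (s := n)
    (by have : (0:ℝ) ≤ n := n.cast_nonneg
        linarith)
  refine (h.const_mul (Real.sqrt (2 * Real.pi))⁻¹).congr (ae_of_all _ fun t => ?_)
  simp only [stdNormalPDF, Real.rpow_natCast]
  rw [show -(1/2 : ℝ) * t ^ 2 = -(t^2)/2 by ring]
  ring

lemma aux_deriv (t : ℝ) : HasDerivAt stdNormalPDF (-t * stdNormalPDF t) t := by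
  have h1 : HasDerivAt (fun t : ℝ => -(t ^ 2) / 2) (-t) t := by
    have := ((hasDerivAt_pow 2 t).neg.div_const 2)
    convert! this using 1
    simp; ring
  have := (h1.exp).const_mul (Real.sqrt (2 * Real.pi))⁻¹
  convert! this using 1
  simp only [stdNormalPDF]; ring

lemma aux_m0 : ∫ t : ℝ, t ^ 0 * stdNormalPDF t = 1 := by
  have h := integral_gaussian (1/2)
  have : (fun t : ℝ => t ^ 0 * stdNormalPDF t) =
      fun t => (Real.sqrt (2 * Real.pi))⁻¹ * Real.exp (-(1/2) * t ^ 2) := by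
    ext t
    simp only [stdNormalPDF]
    rw [show -(1/2 : ℝ) * t ^ 2 = -(t^2)/2 by ring]
    ring
  rw [this, integral_const_mul, h, show Real.pi / (1/2) = 2 * Real.pi by ring]
  exact inv_mul_cancel₀ (by positivity)

lemma aux_m1 : ∫ t : ℝ, t ^ 1 * stdNormalPDF t = 0 := by
  have h := integral_eq_zero_of_hasDerivAt_of_integrable (f := stdNormalPDF)
    (f' := fun t => -t * stdNormalPDF t) (fun t => aux_deriv t)
    (by simpa using (aux_integrable 1).neg) (by simpa using aux_integrable 0)
  simp only [neg_mul, integral_neg] at h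
  simpa using h

lemma aux_rec (n : ℕ) : ∫ t : ℝ, t ^ (n+2) * stdNormalPDF t
    = (n+1) * ∫ t : ℝ, t ^ n * stdNormalPDF t := by
  have hi : Integrable (fun t : ℝ => (n+1 : ℝ) * (t ^ n * stdNormalPDF t)
      - t ^ (n+2) * stdNormalPDF t) :=
    ((aux_integrable n).const_mul _).sub (aux_integrable (n+2))
  have h := integral_eq_zero_of_hasDerivAt_of_integrable
    (f := fun t => t ^ (n+1) * stdNormalPDF t)
    (f' := fun t => (n+1 : ℝ) * (t ^ n * stdNormalPDF t) - t ^ (n+2) * stdNormalPDF t)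
    (fun t => by
      have := (hasDerivAt_pow (n+1) t).mul (aux_deriv t)
      convert! this using 1
      push_cast
      try simp only [Nat.add_sub_cancel]
      ring) hi (aux_integrable (n+1))
  rw [integral_sub ((aux_integrable n).const_mul _) (aux_integrable (n+2)),
    integral_const_mul] at h
  linarith

lemma aux_m2 : ∫ t : ℝ, t ^ 2 * stdNormalPDF t = 1 := by
  have := aux_rec 0
  rw [aux_m0] at this
  simpa using this

lemma aux_m3 : ∫ t : ℝ, t ^ 3 * stdNormalPDF t = 0 := by
  have := aux_rec 1
  rw [aux_m1] at this
  simpa using this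

lemma aux_m4 : ∫ t : ℝ, t ^ 4 * stdNormalPDF t = 3 := by
  have := aux_rec 2
  rw [aux_m2] at this
  rw [this]; norm_num

lemma aux_taylor (g : ℝ → ℝ) (hg_bdd : ∃ C, ∀ t, |g t| ≤ C)
    (hg_smooth : ∃ U : Set ℝ, IsOpen U ∧ (0 : ℝ) ∈ U ∧ ContDiffOn ℝ 4 g U)
    (hg'0 : deriv g 0 = 0) :
    ∃ M, 0 ≤ M ∧ ∀ u, |g u - (g 0 + iteratedDeriv 2 g 0 / 2 * u ^ 2
      + iteratedDeriv 3 g 0 / 6 * u ^ 3)| ≤ M * u ^ 4 := by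
  obtain ⟨C, hC⟩ := hg_bdd
  obtain ⟨U, hU, h0, hs⟩ := hg_smooth
  obtain ⟨r, hr, hrU⟩ := Metric.isOpen_iff.1 hU 0 h0
  have h0r : (0:ℝ) ∈ Metric.ball (0:ℝ) r := Metric.mem_ball_self hr
  have ht := taylor_isLittleO (n := 4) (convex_ball (0:ℝ) r) h0r (hs.mono hrU)
  rw [Metric.isOpen_ball.nhdsWithin_eq h0r] at ht
  have hb := ht.bound (c := 1) one_pos
  obtain ⟨d, hd, hdb⟩ := Metric.eventually_nhds_iff.1 hb
  have hit : ∀ k, iteratedDerivWithin k g (Metric.ball 0 r) 0 = iteratedDeriv k g 0 :=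
    fun k => iteratedDerivWithin_of_isOpen Metric.isOpen_ball h0r
  generalize hA : iteratedDeriv 2 g 0 = A
  generalize hB : iteratedDeriv 3 g 0 = B
  generalize hD : iteratedDeriv 4 g 0 = D
  have hC0 : 0 ≤ C := (abs_nonneg _).trans (hC 0)
  refine ⟨(1 + |D| / 24) + ((C + C) / d ^ 4 + |A| / 2 / d ^ 2 + |B| / 6 / d), by positivity,
    fun u => ?_⟩
  have hE1 : 0 ≤ 1 + |D| / 24 := by positivity
  have hE2 : 0 ≤ (C + C) / d ^ 4 + |A| / 2 / d ^ 2 + |B| / 6 / d := by positivity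
  have hu4 : 0 ≤ u ^ 4 := by positivity
  rcases lt_or_ge |u| d with hu | hu
  · have h1 := hdb (y := u) (by simpa using hu)
    simp only [taylorWithinEval_succ, taylor_within_zero_eval, hit] at h1
    norm_num [hA, hB, hD, Nat.factorial, hg'0] at h1
    have e4 : |u| ^ 4 = u ^ 4 := by rw [← abs_pow, abs_of_nonneg hu4]
    rw [e4] at h1
    have h2 : |g u - (g 0 + A / 2 * u ^ 2 + B / 6 * u ^ 3)| ≤ u ^ 4 + |D| / 24 * u ^ 4 := by
      rw [abs_le] at h1 ⊢
      have h3 := mul_le_mul_of_nonneg_right (neg_abs_le D) hu4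
      have h4 := mul_le_mul_of_nonneg_right (le_abs_self D) hu4
      constructor <;> nlinarith [h1.1, h1.2]
    nlinarith [mul_nonneg hE2 hu4]
  · have e4 : |u| ^ 4 = u ^ 4 := by rw [← abs_pow, abs_of_nonneg hu4]
    have hu0 : 0 ≤ |u| := abs_nonneg u
    have b1 : (C + C) ≤ (C + C) / d ^ 4 * u ^ 4 := by
      rw [div_mul_eq_mul_div, le_div_iff₀ (by positivity), ← e4]; gcongr
    have b2 : |A| / 2 * |u| ^ 2 ≤ |A| / 2 / d ^ 2 * u ^ 4 := by
      rw [div_mul_eq_mul_div (|A| / 2), le_div_iff₀ (by positivity), ← e4, mul_assoc,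
        show |u| ^ 4 = |u| ^ 2 * |u| ^ 2 by ring]; gcongr
    have b3 : |B| / 6 * |u| ^ 3 ≤ |B| / 6 / d * u ^ 4 := by
      rw [div_mul_eq_mul_div (|B| / 6), le_div_iff₀ (by positivity), ← e4, mul_assoc,
        show |u| ^ 4 = |u| ^ 3 * |u| by ring]; gcongr
    have b4 : |g u - (g 0 + A / 2 * u ^ 2 + B / 6 * u ^ 3)|
        ≤ C + (C + |A| / 2 * |u| ^ 2 + |B| / 6 * |u| ^ 3) := by
      refine (abs_sub _ _).trans (add_le_add (hC u) ?_)
      refine (abs_add_le _ _).trans (add_le_add ((abs_add_le _ _).trans (add_le_add (hC 0) ?_)) ?_)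
      · rw [abs_mul, abs_div, abs_pow]; norm_num
      · rw [abs_mul, abs_div, abs_pow]; norm_num
    nlinarith [mul_nonneg hE1 hu4]

lemma aux_nonneg (t : ℝ) : 0 ≤ stdNormalPDF t := by
  unfold stdNormalPDF; positivity

lemma aux_meas : Measurable stdNormalPDF := by
  unfold stdNormalPDF; fun_prop

lemma aux_poly (p A B h a : ℝ) :
    Integrable (fun t : ℝ => t * stdNormalPDF t *
      (p + A / 2 * (t * h - a) ^ 2 + B / 6 * (t * h - a) ^ 3)) ∧
    ∫ t : ℝ, t * stdNormalPDF t *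
      (p + A / 2 * (t * h - a) ^ 2 + B / 6 * (t * h - a) ^ 3)
      = -A * h * a + B / 2 * h ^ 3 + B / 2 * h * a ^ 2 := by
  have i1 := (aux_integrable 1).const_mul (p + A / 2 * a ^ 2 - B / 6 * a ^ 3)
  have i2 := (aux_integrable 2).const_mul (- A * h * a + B / 2 * h * a ^ 2)
  have i3 := (aux_integrable 3).const_mul (A / 2 * h ^ 2 - B / 2 * h ^ 2 * a)
  have i4 := (aux_integrable 4).const_mul (B / 6 * h ^ 3)
  have e : (fun t : ℝ => t * stdNormalPDF t *
      (p + A / 2 * (t * h - a) ^ 2 + B / 6 * (t * h - a) ^ 3)) = fun t =>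
      (p + A / 2 * a ^ 2 - B / 6 * a ^ 3) * (t ^ 1 * stdNormalPDF t)
      + (- A * h * a + B / 2 * h * a ^ 2) * (t ^ 2 * stdNormalPDF t)
      + (A / 2 * h ^ 2 - B / 2 * h ^ 2 * a) * (t ^ 3 * stdNormalPDF t)
      + (B / 6 * h ^ 3) * (t ^ 4 * stdNormalPDF t) := by
    ext t; ring
  rw [e]
  refine ⟨((i1.add i2).add i3).add i4, ?_⟩
  rw [integral_add (by exact (i1.add i2).add i3) i4, integral_add (by exact i1.add i2) i3,
    integral_add i1 i2]
  simp only [integral_const_mul, aux_m1, aux_m2, aux_m3, aux_m4]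
  ring

lemma aux_main (g : ℝ → ℝ) (hg_meas : Measurable g) (hg_bdd : ∃ C, ∀ t, |g t| ≤ C)
    (hg_smooth : ∃ U : Set ℝ, IsOpen U ∧ (0 : ℝ) ∈ U ∧ ContDiffOn ℝ 4 g U)
    (hg'0 : deriv g 0 = 0) :
    ∃ K, 0 ≤ K ∧ ∀ h a : ℝ, 0 < h → |a| ≤ h →
      |(∫ t, t * stdNormalPDF t * g (t * h - a)) -
        (-(iteratedDeriv 2 g 0) * h * a + (iteratedDeriv 3 g 0) / 2 * h ^ 3)|
        ≤ K * (h ^ 4 + h * |a| * |a|) := by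
  obtain ⟨M, hM, hR⟩ := aux_taylor g hg_bdd hg_smooth hg'0
  obtain ⟨C, hC⟩ := hg_bdd
  generalize iteratedDeriv 2 g 0 = A at *
  generalize iteratedDeriv 3 g 0 = B at *
  set W : ℝ → ℝ := fun t => |t| * (|t| + 1) ^ 4 * stdNormalPDF t with hW
  have hWi : Integrable W := by
    have : Integrable (fun t : ℝ => 16 * (t ^ 0 * stdNormalPDF t)
        + 16 * (t ^ 6 * stdNormalPDF t)) :=
      ((aux_integrable 0).const_mul 16).add ((aux_integrable 6).const_mul 16)
    refine (this.const_mul 2).mono' ?_ (ae_of_all _ fun t => ?_)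
    · exact (by have := aux_meas; fun_prop : Measurable W).aestronglyMeasurable
    · have hp := aux_nonneg t
      have ht := abs_nonneg t
      have e6 : t ^ 6 = |t| ^ 6 := by rw [← abs_pow, abs_of_nonneg (by positivity)]
      rw [Real.norm_of_nonneg (by positivity)]
      simp only [hW]
      rw [show 2 * (16 * (t ^ 0 * stdNormalPDF t) + 16 * (t ^ 6 * stdNormalPDF t))
        = (32 + 32 * t ^ 6) * stdNormalPDF t by ring, e6]
      refine mul_le_mul_of_nonneg_right ?_ hp
      rcases le_total |t| 1 with h1 | h1
      · have : |t| * (|t| + 1) ^ 4 ≤ 1 * (1 + 1) ^ 4 := by gcongr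
        have : 0 ≤ |t| ^ 6 := by positivity
        linarith
      · have : |t| * (|t| + 1) ^ 4 ≤ |t| ^ 2 * (|t| + |t|) ^ 4 := by
          gcongr
          nlinarith
        nlinarith [pow_nonneg ht 6]
  have hW0 : 0 ≤ ∫ t, W t := integral_nonneg fun t => by
    have hp := aux_nonneg t
    simp only [hW, Pi.zero_apply]; positivity
  refine ⟨M * (∫ t, W t) + |B| / 2, by positivity, fun h a hh ha => ?_⟩
  obtain ⟨hPi, hPe⟩ := aux_poly (g 0) A B h a
  have hgi : Integrable (fun t => t * stdNormalPDF t * g (t * h - a)) := by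
    refine Integrable.mul_bdd (c := C) (by simpa using aux_integrable 1)
      (hg_meas.comp (by fun_prop : Measurable fun t : ℝ => t * h - a)).aestronglyMeasurable
      (ae_of_all _ fun t => ?_)
    simpa using hC (t * h - a)
  have key : |∫ t, (t * stdNormalPDF t * g (t * h - a) - t * stdNormalPDF t *
      (g 0 + A / 2 * (t * h - a) ^ 2 + B / 6 * (t * h - a) ^ 3))|
      ≤ ∫ t, M * h ^ 4 * W t := by
    rw [← Real.norm_eq_abs]
    refine norm_integral_le_of_norm_le (hWi.const_mul _) (ae_of_all _ fun t => ?_)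
    have hp := aux_nonneg t
    rw [← mul_sub, Real.norm_eq_abs, abs_mul, abs_mul, abs_of_nonneg hp]
    have h1 := hR (t * h - a)
    have h2 : (t * h - a) ^ 4 ≤ ((|t| + 1) * h) ^ 4 := by
      have e4 : (t * h - a) ^ 4 = |t * h - a| ^ 4 := by
        rw [← abs_pow, abs_of_nonneg (by positivity)]
      rw [e4]
      gcongr
      refine (abs_sub _ _).trans ?_
      rw [abs_mul, abs_of_pos hh]
      linarith
    calc |t| * stdNormalPDF t * _ ≤ |t| * stdNormalPDF t * (M * ((|t| + 1) * h) ^ 4) := by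
          gcongr
          exact h1.trans (by gcongr)
      _ = M * h ^ 4 * W t := by simp only [hW]; ring
  rw [integral_sub hgi hPi, hPe, integral_const_mul] at key
  have h5 : |B / 2 * h * a ^ 2| = |B| / 2 * (h * |a| * |a|) := by
    rw [abs_mul, abs_mul, abs_div, abs_of_pos hh, abs_pow, abs_two]
    ring
  have h6 : (∫ t, t * stdNormalPDF t * g (t * h - a)) - (-A * h * a + B / 2 * h ^ 3)
      = ((∫ t, t * stdNormalPDF t * g (t * h - a)) -
        (-A * h * a + B / 2 * h ^ 3 + B / 2 * h * a ^ 2)) + B / 2 * h * a ^ 2 := by ring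
  rw [h6]
  refine (abs_add_le _ _).trans ?_
  rw [h5]
  have n1 : 0 ≤ |B| / 2 * h ^ 4 := by positivity
  have n2 : 0 ≤ M * (∫ t, W t) * (h * |a| * |a|) := by positivity
  linarith

/-- Key integral expansion: if `g : ℝ → ℝ` is bounded, measurable, four times
continuously differentiable near `0` with `g'(0) = 0`, and `h_n > 0`, `h_n → 0`,
`a_n / h_n → 0`, then
`∫ t φ(t) g(t h_n − a_n) dt = −g″(0) h_n a_n + (g‴(0)/2) h_n³ + o(h_n³ + h_n |a_n|)`. -/
theorem key_integral_expansion
    (g : ℝ → ℝ) (hg_meas : Measurable g) (hg_bdd : ∃ C, ∀ t, |g t| ≤ C)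
    (hg_smooth : ∃ U : Set ℝ, IsOpen U ∧ (0 : ℝ) ∈ U ∧ ContDiffOn ℝ 4 g U)
    (hg'0 : deriv g 0 = 0)
    (h a : ℕ → ℝ) (hh_pos : ∀ n, 0 < h n)
    (hh : Tendsto h atTop (nhds 0))
    (ha : Tendsto (fun n => a n / h n) atTop (nhds 0)) :
    (fun n => (∫ t, t * stdNormalPDF t * g (t * h n - a n)) -
        (-(iteratedDeriv 2 g 0) * h n * a n + (iteratedDeriv 3 g 0) / 2 * (h n) ^ 3))
      =o[atTop] (fun n => (h n) ^ 3 + h n * |a n|) := by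
  obtain ⟨K, hK, hmain⟩ := aux_main g hg_meas hg_bdd hg_smooth hg'0
  rw [isLittleO_iff]
  intro c hc
  have h1 : ∀ᶠ n in atTop, |a n| ≤ h n := by
    have := ha.eventually (Metric.ball_mem_nhds 0 one_pos)
    filter_upwards [this] with n hn
    have hn' : |a n / h n| < 1 := by
      rwa [dist_zero_right, Real.norm_eq_abs] at hn
    rw [abs_div, abs_of_pos (hh_pos n), div_lt_one (hh_pos n)] at hn'
    exact hn'.le
  have h2 : ∀ᶠ n in atTop, K * h n ≤ c := by
    have : Tendsto (fun n => K * h n) atTop (nhds 0) := by simpa using hh.const_mul K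
    exact this.eventually (Iic_mem_nhds hc)
  filter_upwards [h1, h2] with n hn1 hn2
  have hp := hh_pos n
  have hab := abs_nonneg (a n)
  rw [Real.norm_eq_abs, Real.norm_of_nonneg (by positivity)]
  refine (hmain (h n) (a n) hp hn1).trans ?_
  calc K * (h n ^ 4 + h n * |a n| * |a n|) ≤ K * (h n ^ 4 + h n * |a n| * h n) := by gcongr
    _ = (K * h n) * (h n ^ 3 + h n * |a n|) := by ring
    _ ≤ c * (h n ^ 3 + h n * |a n|) := by gcongr
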